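/- Law of order estimation, Case I with m even and (ε,δ) ≠ (1,1): if the characteristic exponent m is an even nonnegative integer and not both ε = 1 and δ = 1, then the averaged T¹-type quantity satisfies ⟨A⟩(Δr) = O(Δr^m) as Δr → 0⁺, i.e. Δr^{−m}·⟨A⟩(Δr) stays bounded for small Δr > 0. -/

import Mathlib

open Filter Finset

noncomputable section

/-- Transition probability η on trits: η(0) = (β/2)(1 − Pe/2), η(1) = 1 − β,
η(2) = (β/2)(1 + Pe/2). -/
def eta (β Pe : ℝ) (ω : Fin 3) : ℝ :=
  if (ω : ℕ) = 0 then β / 2 * (1 - Pe / 2)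
  else if (ω : ℕ) = 1 then 1 - β
  else β / 2 * (1 + Pe / 2)

/-- ν(ω) = η(2 − ω). -/
def nu (β Pe : ℝ) (ω : Fin 3) : ℝ :=
  if (ω : ℕ) = 0 then β / 2 * (1 + Pe / 2)
  else if (ω : ℕ) = 1 then 1 - β
  else β / 2 * (1 - Pe / 2)

/-- Bulk local density ρ̂ⱼ(u′) = (∏ η(u_d)/ν(u_d)) · ρ₀(r + (j + Σ (1 − u_d))·Δr). -/
def rhoHat (β Pe r Δr : ℝ) (ρ₀ : ℝ → ℝ) {K : ℕ} (j : ℤ) (u : Fin K → Fin 3) : ℝ :=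
  (∏ d, eta β Pe (u d) / nu β Pe (u d)) *
    ρ₀ (r + ((j : ℝ) + ∑ d, (1 - ((u d : ℕ) : ℝ))) * Δr)

/-- F_j(ω, u) with u = u₀u′ :
F_j(ω,u) = f((η(ω)/ν(ω))·ρ̂_j(u′), (η(u₀)/ν(u₀))·ρ̂_{j+1−u₀}(u′)). -/
def Floc (β Pe r Δr : ℝ) (ρ₀ : ℝ → ℝ) (f : ℝ → ℝ → ℝ) {K : ℕ}
    (j : ℤ) (ω u₀ : Fin 3) (u' : Fin K → Fin 3) : ℝ :=
  f (eta β Pe ω / nu β Pe ω * rhoHat β Pe r Δr ρ₀ j u')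
    (eta β Pe u₀ / nu β Pe u₀ * rhoHat β Pe r Δr ρ₀ (j + 1 - ((u₀ : ℕ) : ℤ)) u')

/-- K(Δr): the sum over the trit ω and the k-digit trit string u = u₀u′. -/
def Ksum (D v β r : ℝ) (k : ℕ) (ρ₀ : ℝ → ℝ) (f : ℝ → ℝ → ℝ)
    (ε δ : ℝ) (m : ℕ) (Δr : ℝ) : ℝ :=
  Δr * ∑ ω : Fin 3, ∑ u₀ : Fin 3, ∑ u' : Fin (k - 1) → Fin 3,
    (eta β (v * Δr / D) ω + δ * nu β (v * Δr / D) ω) *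
      (nu β (v * Δr / D) u₀ * ∏ d, nu β (v * Δr / D) (u' d)) *
      (Floc β (v * Δr / D) r Δr ρ₀ f 0 ω u₀ u' +
        ε * (-1 : ℝ) ^ m * Floc β (v * Δr / D) r Δr ρ₀ f (1 - ((ω : ℕ) : ℤ)) ω u₀ u')

/-- The spatio-temporally averaged T¹-type quantity ⟨A⟩(Δr) = K/(τ·Δr),
with τ = β·Δr²/(2D). -/
def avgA (D v β r : ℝ) (k : ℕ) (ρ₀ : ℝ → ℝ) (f : ℝ → ℝ → ℝ)
    (ε δ : ℝ) (m : ℕ) (Δr : ℝ) : ℝ :=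
  Ksum D v β r k ρ₀ f ε δ m Δr / (β * Δr ^ 2 / (2 * D) * Δr)

/-- f̃(X,Y) = f(Y + X, Y − X). -/
def ftilde (f : ℝ → ℝ → ℝ) (X Y : ℝ) : ℝ := f (Y + X) (Y - X)

open Topology Asymptotics

/-- Peano form of Taylor's theorem at `0`, for functions smooth near `0` only. -/
theorem ContDiffAt.sub_taylor_isLittleO {q : ℝ → ℝ} {n : ℕ} (hq : ContDiffAt ℝ n q 0) :
    (fun x => q x - ∑ k ∈ range (n + 1), ((k.factorial : ℝ)⁻¹ * x ^ k) * iteratedDeriv k q 0)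
      =o[𝓝 0] fun x => x ^ n := by
  obtain ⟨u, hu, hqu⟩ := hq.contDiffOn (m := n) le_rfl (by simp)
  obtain ⟨b, hb, hbu⟩ := Metric.mem_nhds_iff.1 hu
  have h0 : (0 : ℝ) ∈ Metric.ball (0 : ℝ) b := Metric.mem_ball_self hb
  have h := taylor_isLittleO (convex_ball (0 : ℝ) b) h0 (hqu.mono hbu)
  rw [Metric.isOpen_ball.nhdsWithin_eq h0] at h
  simpa only [taylor_within_apply, iteratedDerivWithin_of_isOpen Metric.isOpen_ball h0,
    sub_zero, smul_eq_mul] using h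

/-- A function that is smooth near `0` and `o(x ^ m)` has vanishing derivatives up to order `m`. -/
theorem iteratedDeriv_eq_zero_of_isLittleO {q : ℝ → ℝ} {m : ℕ} (hq : ContDiffAt ℝ m q 0)
    (ho : q =o[𝓝[>] 0] fun x => x ^ m) (i : ℕ) (hi : i ≤ m) : iteratedDeriv i q 0 = 0 := by
  induction i using Nat.strong_induction_on with
  | _ i ih =>
    have ht := ((hq.of_le (by exact_mod_cast hi)).sub_taylor_isLittleO (n := i)).mono
      (nhdsWithin_le_nhds (s := Set.Ioi 0))
    have hoi : q =o[𝓝[>] 0] fun x => x ^ i := by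
      refine ho.trans_isBigO (IsBigO.of_bound 1 ?_)
      filter_upwards [Ioo_mem_nhdsGT (zero_lt_one (α := ℝ))] with x hx
      rw [one_mul, norm_pow, norm_pow]
      refine pow_le_pow_of_le_one (norm_nonneg _) ?_ hi
      rw [Real.norm_of_nonneg hx.1.le]
      exact hx.2.le
    have hc := hoi.sub ht
    have hsum : ∀ x : ℝ, ∑ k ∈ range (i + 1), ((k.factorial : ℝ)⁻¹ * x ^ k) * iteratedDeriv k q 0
        = (i.factorial : ℝ)⁻¹ * iteratedDeriv i q 0 * x ^ i := by
      intro x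
      rw [sum_range_succ, sum_eq_zero, zero_add]
      · ring
      · intro k hk
        rw [ih k (mem_range.1 hk) ((mem_range.1 hk).le.trans hi), mul_zero]
    simp only [sub_sub_cancel, hsum] at hc
    have hlim := hc.tendsto_div_nhds_zero
    have hconst : Tendsto (fun _ : ℝ => (i.factorial : ℝ)⁻¹ * iteratedDeriv i q 0)
        (𝓝[>] 0) (𝓝 0) := by
      refine hlim.congr' ?_
      filter_upwards [self_mem_nhdsWithin] with x hx
      rw [mul_div_cancel_right₀ _ (pow_ne_zero _ (ne_of_gt hx))]
    have hz := tendsto_nhds_unique hconst tendsto_const_nhds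
    rcases mul_eq_zero.1 hz.symm with h | h
    · exact absurd h (inv_ne_zero (by positivity))
    · exact h

/-- An even function, smooth near `0`, that is `o(x ^ m)` with `m` even is `O(x ^ (m + 2))`. -/
theorem isBigO_pow_add_two_of_even {q : ℝ → ℝ} {m : ℕ} (hm : Even m)
    (hq : ContDiffAt ℝ (m + 2 : ℕ) q 0) (heven : ∀ x, q (-x) = q x)
    (ho : q =o[𝓝[>] 0] fun x => x ^ m) : q =O[𝓝 0] fun x => x ^ (m + 2) := by
  have hlow := iteratedDeriv_eq_zero_of_isLittleO (hq.of_le (by norm_cast; omega)) ho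
  have hodd : iteratedDeriv (m + 1) q 0 = 0 := by
    have h := iteratedDeriv_comp_neg (m + 1) q 0
    simp only [heven, neg_zero, hm.add_one.neg_one_pow, smul_eq_mul] at h
    linarith
  have hsum : ∀ x : ℝ, ∑ k ∈ range (m + 2 + 1), ((k.factorial : ℝ)⁻¹ * x ^ k) * iteratedDeriv k q 0
      = ((m + 2).factorial : ℝ)⁻¹ * iteratedDeriv (m + 2) q 0 * x ^ (m + 2) := by
    intro x
    rw [sum_range_succ, sum_range_succ, hodd, sum_eq_zero]
    · ring
    · intro k hk
      rw [hlow k (Nat.lt_succ_iff.1 (mem_range.1 hk)), mul_zero]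
  have ht := hq.sub_taylor_isLittleO.isBigO
  simp only [hsum] at ht
  simpa using ht.add (isBigO_const_mul_self
    (((m + 2).factorial : ℝ)⁻¹ * iteratedDeriv (m + 2) q 0) (fun x : ℝ => x ^ (m + 2)) (𝓝 0))

/-- Partial derivatives in the first variable of a smooth function are jointly smooth. -/
theorem contDiff_iteratedDeriv_fst {g : ℝ → ℝ → ℝ}
    (hg : ContDiff ℝ (⊤ : ℕ∞) (Function.uncurry g)) (n : ℕ) :
    ContDiff ℝ (⊤ : ℕ∞) fun p : ℝ × ℝ => iteratedDeriv n (fun X => g X p.2) p.1 := by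
  induction n with
  | zero =>
    simp only [iteratedDeriv_zero]
    exact hg
  | succ n ih =>
    simp only [iteratedDeriv_succ, ← fderiv_apply_one_eq_deriv]
    refine ContDiff.fderiv_apply (m := (⊤ : ℕ∞))
      (f := fun (p : ℝ × ℝ) => iteratedDeriv n fun X => g X p.2) ?_ contDiff_fst contDiff_const
      (by simp)
    exact ih.comp (contDiff_snd.prodMk (contDiff_snd.comp contDiff_fst))

/-- Lagrange's remainder along the segment from `0` to `X`. -/
theorem exists_eq_pow_mul_iteratedDeriv {g : ℝ → ℝ} (hg : ContDiff ℝ (⊤ : ℕ∞) g) {m : ℕ}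
    (hlow : ∀ j < m, iteratedDeriv j g 0 = 0) (X : ℝ) :
    ∃ t ∈ Set.Icc (0 : ℝ) 1, g X = X ^ m * iteratedDeriv m g (t * X) / m.factorial := by
  rcases m with _ | n
  · exact ⟨1, by simp, by simp⟩
  by_cases hX : X = 0
  · refine ⟨0, by simp, ?_⟩
    have h := hlow 0 (Nat.succ_pos n)
    simp only [iteratedDeriv_zero] at h
    simp [hX, h]
  · obtain ⟨y, hy, h⟩ := taylor_mean_remainder_lagrange_iteratedDeriv (f := g) (n := n)
      (Ne.symm hX) (hg.of_le (by exact_mod_cast le_top)).contDiffOn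
    have hT : taylorWithinEval g n (Set.uIcc 0 X) 0 X = 0 := by
      rw [taylor_within_apply]
      refine sum_eq_zero fun k hk => ?_
      rw [iteratedDerivWithin_eq_iteratedDeriv (uniqueDiffOn_uIcc (Ne.symm hX))
        (hg.of_le (by exact_mod_cast le_top)).contDiffAt Set.left_mem_uIcc,
        hlow k (mem_range.1 hk), smul_zero]
    refine ⟨y / X, ?_, ?_⟩
    · have hy' : y ∈ Set.uIcc 0 X := Set.Ioo_subset_Icc_self hy
      rcases lt_or_gt_of_ne hX with hneg | hpos
      · rw [Set.uIcc_of_ge hneg.le] at hy'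
        exact ⟨div_nonneg_of_nonpos hy'.2 hneg.le, (div_le_one_of_neg hneg).2 hy'.1⟩
      · rw [Set.uIcc_of_le hpos.le] at hy'
        exact ⟨div_nonneg hy'.1 hpos.le, (div_le_one hpos).2 hy'.2⟩
    · rw [hT, sub_zero, sub_zero] at h
      rw [div_mul_cancel₀ _ hX, h]
      ring

/-- Leading-order behaviour of `g (X h) (Y h)` when `g` vanishes to order `m` along `X = 0`. -/
theorem tendsto_div_pow_of_vanishing {g : ℝ → ℝ → ℝ}
    (hg : ContDiff ℝ (⊤ : ℕ∞) (Function.uncurry g)) {m : ℕ}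
    (hlow : ∀ Y : ℝ, ∀ j < m, iteratedDeriv j (fun X => g X Y) 0 = 0)
    {X Y : ℝ → ℝ} {x y : ℝ} (hX : HasDerivAt X x 0) (hX0 : X 0 = 0)
    (hY : ContinuousAt Y 0) (hY0 : Y 0 = y) :
    Tendsto (fun h => g (X h) (Y h) / h ^ m) (𝓝[>] 0)
      (𝓝 (x ^ m * iteratedDeriv m (fun X => g X y) 0 / m.factorial)) := by
  have hsm : ∀ Y : ℝ, ContDiff ℝ (⊤ : ℕ∞) fun X => g X Y := fun Y =>
    hg.comp (contDiff_id.prodMk contDiff_const)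
  choose t ht hgt using fun h =>
    exists_eq_pow_mul_iteratedDeriv (hsm (Y h)) (hlow (Y h)) (X h)
  have hslope : Tendsto (fun h => X h / h) (𝓝[>] 0) (𝓝 x) := by
    have h := (hasDerivAt_iff_tendsto_slope.1 hX).mono_left
      (nhdsWithin_mono _ (fun a (ha : (0 : ℝ) < a) => ne_of_gt ha) : 𝓝[>] (0 : ℝ) ≤ 𝓝[≠] 0)
    refine h.congr fun a => ?_
    simp [slope_def_field, hX0]
  have hXt : Tendsto X (𝓝[>] 0) (𝓝 0) := by
    simpa [hX0] using hX.continuousAt.tendsto.mono_left nhdsWithin_le_nhds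
  have hYt : Tendsto Y (𝓝[>] 0) (𝓝 y) := by
    simpa [hY0] using hY.tendsto.mono_left nhdsWithin_le_nhds
  have htX : Tendsto (fun h => t h * X h) (𝓝[>] 0) (𝓝 0) := by
    refine squeeze_zero_norm (fun h => ?_) (tendsto_zero_iff_norm_tendsto_zero.1 hXt)
    rw [norm_mul, Real.norm_of_nonneg (ht h).1]
    exact mul_le_of_le_one_left (norm_nonneg _) (ht h).2
  have hder : Tendsto (fun h => iteratedDeriv m (fun X => g X (Y h)) (t h * X h)) (𝓝[>] 0)
      (𝓝 (iteratedDeriv m (fun X => g X y) 0)) :=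
    ((contDiff_iteratedDeriv_fst hg m).continuous.tendsto (0, y)).comp (htX.prodMk_nhds hYt)
  refine (((hslope.pow m).mul hder).div_const _).congr fun h => ?_
  rw [hgt h, div_pow]
  ring

theorem eta_neg_rev (β Pe : ℝ) (ω : Fin 3) : eta β (-Pe) ω.rev = eta β Pe ω := by
  fin_cases ω <;> simp [eta, Fin.rev, sub_eq_add_neg, neg_div]

theorem nu_neg_rev (β Pe : ℝ) (ω : Fin 3) : nu β (-Pe) ω.rev = nu β Pe ω := by
  fin_cases ω <;> simp [nu, Fin.rev, sub_eq_add_neg, neg_div]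

theorem one_sub_rev (ω : Fin 3) : (1 - ((ω.rev : ℕ) : ℤ)) = -(1 - ((ω : ℕ) : ℤ)) := by
  fin_cases ω <;> simp [Fin.rev]

theorem one_sub_rev_real (ω : Fin 3) : (1 - ((ω.rev : ℕ) : ℝ)) = -(1 - ((ω : ℕ) : ℝ)) := by
  exact_mod_cast one_sub_rev ω

theorem rhoHat_reflect (β Pe r h : ℝ) (ρ₀ : ℝ → ℝ) {K : ℕ} (j : ℤ) (u : Fin K → Fin 3) :
    rhoHat β (-Pe) r (-h) ρ₀ (-j) (fun d => (u d).rev) = rhoHat β Pe r h ρ₀ j u := by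
  simp only [rhoHat, eta_neg_rev, nu_neg_rev, one_sub_rev_real, sum_neg_distrib, Int.cast_neg]
  congr 2
  ring

theorem Floc_reflect (β Pe r h : ℝ) (ρ₀ : ℝ → ℝ) (f : ℝ → ℝ → ℝ) {K : ℕ}
    (j : ℤ) (ω u₀ : Fin 3) (u : Fin K → Fin 3) :
    Floc β (-Pe) r (-h) ρ₀ f (-j) ω.rev u₀.rev (fun d => (u d).rev) =
      Floc β Pe r h ρ₀ f j ω u₀ u := by
  have hj : -j + 1 - ((u₀.rev : ℕ) : ℤ) = -(j + 1 - ((u₀ : ℕ) : ℤ)) := by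
    linarith [one_sub_rev u₀]
  simp only [Floc, eta_neg_rev, nu_neg_rev, rhoHat_reflect, hj]

/-- The sum in `Ksum` without the prefactor `Δr`. -/
def siteSum (D v β r : ℝ) (K : ℕ) (ρ₀ : ℝ → ℝ) (f : ℝ → ℝ → ℝ) (ε δ : ℝ) (h : ℝ) : ℝ :=
  ∑ ω : Fin 3, ∑ u₀ : Fin 3, ∑ u' : Fin K → Fin 3,
    (eta β (v * h / D) ω + δ * nu β (v * h / D) ω) *
      (nu β (v * h / D) u₀ * ∏ d, nu β (v * h / D) (u' d)) *
      (Floc β (v * h / D) r h ρ₀ f 0 ω u₀ u' +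
        ε * Floc β (v * h / D) r h ρ₀ f (1 - ((ω : ℕ) : ℤ)) ω u₀ u')

/-- Reflecting all trits together with the sign of the step leaves the site sum unchanged. -/
theorem siteSum_neg (D v β r : ℝ) (K : ℕ) (ρ₀ : ℝ → ℝ) (f : ℝ → ℝ → ℝ) (ε δ h : ℝ) :
    siteSum D v β r K ρ₀ f ε δ (-h) = siteSum D v β r K ρ₀ f ε δ h := by
  have hPe : v * -h / D = -(v * h / D) := by ring
  unfold siteSum
  rw [hPe, ← Equiv.sum_comp Fin.revPerm]
  refine sum_congr rfl fun ω _ => ?_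
  rw [← Equiv.sum_comp Fin.revPerm]
  refine sum_congr rfl fun u₀ _ => ?_
  rw [← Equiv.sum_comp (Equiv.piCongrRight fun _ : Fin K => (Fin.revPerm : Equiv.Perm (Fin 3)))]
  refine sum_congr rfl fun u' _ => ?_
  have h0 := Floc_reflect β (v * h / D) r h ρ₀ f 0 ω u₀ u'
  have h1 := Floc_reflect β (v * h / D) r h ρ₀ f (1 - ((ω : ℕ) : ℤ)) ω u₀ u'
  rw [neg_zero] at h0
  rw [← one_sub_rev] at h1
  simp only [Fin.revPerm_apply, Equiv.piCongrRight_apply, Pi.map_apply, eta_neg_rev, nu_neg_rev]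
  rw [← h0, ← h1]
  rfl

theorem contDiff_eta (D v β : ℝ) (ω : Fin 3) :
    ContDiff ℝ (⊤ : ℕ∞) fun h : ℝ => eta β (v * h / D) ω := by
  unfold eta
  split_ifs <;> fun_prop

theorem contDiff_nu (D v β : ℝ) (ω : Fin 3) :
    ContDiff ℝ (⊤ : ℕ∞) fun h : ℝ => nu β (v * h / D) ω := by
  unfold nu
  split_ifs <;> fun_prop

theorem eta_zero_eq_nu_zero (β : ℝ) (ω : Fin 3) : eta β 0 ω = nu β 0 ω := by
  simp [eta, nu]

theorem nu_zero_ne_zero {β : ℝ} (hβ0 : 0 < β) (hβ1 : β < 1) (ω : Fin 3) : nu β 0 ω ≠ 0 := by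
  have h1 : 1 - β ≠ 0 := by linarith
  unfold nu
  split_ifs <;> simp [hβ0.ne', h1]

theorem contDiffAt_ratio (D v : ℝ) {β : ℝ} (hβ0 : 0 < β) (hβ1 : β < 1) (ω : Fin 3) :
    ContDiffAt ℝ (⊤ : ℕ∞) (fun h : ℝ => eta β (v * h / D) ω / nu β (v * h / D) ω) 0 :=
  (contDiff_eta D v β ω).contDiffAt.div (contDiff_nu D v β ω).contDiffAt
    (by simpa using nu_zero_ne_zero hβ0 hβ1 ω)

theorem ratio_zero (D v : ℝ) {β : ℝ} (hβ0 : 0 < β) (hβ1 : β < 1) (ω : Fin 3) :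
    eta β (v * 0 / D) ω / nu β (v * 0 / D) ω = 1 := by
  simp [eta_zero_eq_nu_zero, div_self (nu_zero_ne_zero hβ0 hβ1 ω)]

theorem contDiffAt_ratio_mul_rhoHat (D v r : ℝ) {β : ℝ} (hβ0 : 0 < β) (hβ1 : β < 1)
    {ρ₀ : ℝ → ℝ} (hρ : ContDiff ℝ (⊤ : ℕ∞) ρ₀) {K : ℕ} (j : ℤ) (ω : Fin 3) (u : Fin K → Fin 3) :
    ContDiffAt ℝ (⊤ : ℕ∞) (fun h : ℝ => eta β (v * h / D) ω / nu β (v * h / D) ω *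
      rhoHat β (v * h / D) r h ρ₀ j u) 0 := by
  unfold rhoHat
  refine (contDiffAt_ratio D v hβ0 hβ1 ω).mul (ContDiffAt.mul ?_ ?_)
  · exact contDiffAt_prod fun d _ => contDiffAt_ratio D v hβ0 hβ1 (u d)
  · exact (hρ.comp (by fun_prop)).contDiffAt

theorem contDiffAt_Floc (D v r : ℝ) {β : ℝ} (hβ0 : 0 < β) (hβ1 : β < 1)
    {ρ₀ : ℝ → ℝ} (hρ : ContDiff ℝ (⊤ : ℕ∞) ρ₀) {f : ℝ → ℝ → ℝ}
    (hf : ContDiff ℝ (⊤ : ℕ∞) (Function.uncurry f)) {K : ℕ} (j : ℤ) (ω u₀ : Fin 3)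
    (u : Fin K → Fin 3) :
    ContDiffAt ℝ (⊤ : ℕ∞) (fun h : ℝ => Floc β (v * h / D) r h ρ₀ f j ω u₀ u) 0 :=
  hf.contDiffAt.comp (0 : ℝ) ((contDiffAt_ratio_mul_rhoHat D v r hβ0 hβ1 hρ j ω u).prodMk
    (contDiffAt_ratio_mul_rhoHat D v r hβ0 hβ1 hρ (j + 1 - ((u₀ : ℕ) : ℤ)) u₀ u))

theorem contDiffAt_siteSum (D v r : ℝ) {β : ℝ} (hβ0 : 0 < β) (hβ1 : β < 1) (K : ℕ)
    {ρ₀ : ℝ → ℝ} (hρ : ContDiff ℝ (⊤ : ℕ∞) ρ₀) {f : ℝ → ℝ → ℝ}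
    (hf : ContDiff ℝ (⊤ : ℕ∞) (Function.uncurry f)) (ε δ : ℝ) :
    ContDiffAt ℝ (⊤ : ℕ∞) (siteSum D v β r K ρ₀ f ε δ) 0 := by
  unfold siteSum
  refine ContDiffAt.sum fun ω _ => ContDiffAt.sum fun u₀ _ => ContDiffAt.sum fun u' _ => ?_
  have hF := fun j => contDiffAt_Floc D v r hβ0 hβ1 hρ hf j ω u₀ u'
  refine ContDiffAt.mul (ContDiffAt.mul ?_ ?_) ((hF _).add (contDiffAt_const.mul (hF _)))
  · exact ((contDiff_eta D v β ω).add (contDiff_const.mul (contDiff_nu D v β ω))).contDiffAt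
  · exact ((contDiff_nu D v β u₀).mul (contDiff_prod fun d _ => contDiff_nu D v β (u' d))).contDiffAt

theorem hasDerivAt_ratio_mul_rhoHat (D v r : ℝ) {β : ℝ} (hβ0 : 0 < β) (hβ1 : β < 1)
    {ρ₀ : ℝ → ℝ} (hρ : ContDiff ℝ (⊤ : ℕ∞) ρ₀) {K : ℕ} (u : Fin K → Fin 3) :
    ∃ (e : Fin 3 → ℝ) (c : ℝ), ∀ (j : ℤ) (ω : Fin 3),
      HasDerivAt (fun h : ℝ => eta β (v * h / D) ω / nu β (v * h / D) ω *
        rhoHat β (v * h / D) r h ρ₀ j u) (e ω + c + j * deriv ρ₀ r) 0 := by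
  have hne : ((⊤ : ℕ∞) : WithTop ℕ∞) ≠ 0 := by simp
  have hr := fun ω => ((contDiffAt_ratio D v hβ0 hβ1 ω).differentiableAt hne).hasDerivAt
  have hP := ((contDiffAt_prod (t := univ) fun d _ =>
    contDiffAt_ratio D v hβ0 hβ1 (u d)).differentiableAt hne).hasDerivAt
  have hρ' : ∀ s : ℝ, HasDerivAt (fun h : ℝ => ρ₀ (r + s * h)) (deriv ρ₀ r * s) 0 := fun s => by
    have hin : HasDerivAt (fun h : ℝ => r + s * h) s 0 := by
      simpa using ((hasDerivAt_id (0 : ℝ)).const_mul s).const_add r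
    refine HasDerivAt.comp (0 : ℝ) ?_ hin
    simpa using (hρ.contDiffAt.differentiableAt hne : DifferentiableAt ℝ ρ₀ r).hasDerivAt
  refine ⟨fun ω => deriv (fun h : ℝ => eta β (v * h / D) ω / nu β (v * h / D) ω) 0 * ρ₀ r,
    deriv (fun h : ℝ => ∏ d, eta β (v * h / D) (u d) / nu β (v * h / D) (u d)) 0 * ρ₀ r +
      (∑ d, (1 - ((u d : ℕ) : ℝ))) * deriv ρ₀ r, fun j ω => ?_⟩
  unfold rhoHat
  refine ((hr ω).mul (hP.mul (hρ' ((j : ℝ) + ∑ d, (1 - ((u d : ℕ) : ℝ)))))).congr_deriv ?_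
  simp only [Pi.mul_apply, ratio_zero D v hβ0 hβ1, prod_const_one]
  simp only [mul_zero, add_zero]
  ring

/-- The leading coefficient of `Floc` does not depend on the site index `j`. -/
theorem exists_tendsto_Floc_div_pow (D v r : ℝ) {β : ℝ} (hβ0 : 0 < β) (hβ1 : β < 1)
    {ρ₀ : ℝ → ℝ} (hρ : ContDiff ℝ (⊤ : ℕ∞) ρ₀) {f : ℝ → ℝ → ℝ}
    (hf : ContDiff ℝ (⊤ : ℕ∞) (Function.uncurry f)) {m : ℕ}
    (hlow : ∀ Y : ℝ, ∀ j < m, iteratedDeriv j (fun X => ftilde f X Y) 0 = 0)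
    {K : ℕ} (ω u₀ : Fin 3) (u : Fin K → Fin 3) :
    ∃ L : ℝ, ∀ j : ℤ, Tendsto (fun h : ℝ => Floc β (v * h / D) r h ρ₀ f j ω u₀ u / h ^ m)
      (𝓝[>] 0) (𝓝 L) := by
  obtain ⟨e, c, hd⟩ := hasDerivAt_ratio_mul_rhoHat D v r hβ0 hβ1 hρ u
  have hft : ContDiff ℝ (⊤ : ℕ∞) (Function.uncurry (ftilde f)) :=
    hf.comp ((contDiff_snd.add contDiff_fst).prodMk (contDiff_snd.sub contDiff_fst))
  have hval : ∀ (j : ℤ) (ω : Fin 3), eta β (v * 0 / D) ω / nu β (v * 0 / D) ω *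
      rhoHat β (v * 0 / D) r 0 ρ₀ j u = ρ₀ r := fun j ω => by
    simp only [rhoHat, ratio_zero D v hβ0 hβ1, prod_const_one]
    simp only [mul_zero, add_zero, one_mul]
  refine ⟨((e ω - e u₀ - (1 - ((u₀ : ℕ) : ℝ)) * deriv ρ₀ r) / 2) ^ m *
    iteratedDeriv m (fun X => ftilde f X (ρ₀ r)) 0 / m.factorial, fun j => ?_⟩
  have ha := hd j ω
  have hb := hd (j + 1 - ((u₀ : ℕ) : ℤ)) u₀
  have hX := (ha.sub hb).div_const 2
  have hY := (ha.add hb).div_const 2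
  have hx : (e ω + c + (j : ℝ) * deriv ρ₀ r -
      (e u₀ + c + ((j + 1 - ((u₀ : ℕ) : ℤ) : ℤ) : ℝ) * deriv ρ₀ r)) / 2 =
      (e ω - e u₀ - (1 - ((u₀ : ℕ) : ℝ)) * deriv ρ₀ r) / 2 := by
    push_cast
    ring
  rw [hx] at hX
  refine (tendsto_div_pow_of_vanishing hft hlow hX ?_ hY.continuousAt ?_).congr fun h => ?_
  · simp only [Pi.sub_apply, hval, sub_self, zero_div]
  · simp only [Pi.add_apply, hval, add_self_div_two]
  · simp only [ftilde, Floc, Pi.sub_apply, Pi.add_apply]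
    congr 2 <;> ring

theorem siteSum_isLittleO (D v r : ℝ) {β : ℝ} (hβ0 : 0 < β) (hβ1 : β < 1) (K : ℕ)
    {ρ₀ : ℝ → ℝ} (hρ : ContDiff ℝ (⊤ : ℕ∞) ρ₀) {f : ℝ → ℝ → ℝ}
    (hf : ContDiff ℝ (⊤ : ℕ∞) (Function.uncurry f)) {m : ℕ}
    (hlow : ∀ Y : ℝ, ∀ j < m, iteratedDeriv j (fun X => ftilde f X Y) 0 = 0)
    {ε δ : ℝ} (hεδ : ε = -1 ∨ δ = -1) :
    siteSum D v β r K ρ₀ f ε δ =o[𝓝[>] 0] fun h => h ^ m := by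
  unfold siteSum
  refine IsLittleO.fun_sum fun ω _ => IsLittleO.fun_sum fun u₀ _ => IsLittleO.fun_sum fun u' _ => ?_
  obtain ⟨L, hL⟩ := exists_tendsto_Floc_div_pow D v r hβ0 hβ1 hρ hf hlow ω u₀ u'
  refine (isLittleO_iff_tendsto' ?_).2 ?_
  · filter_upwards [self_mem_nhdsWithin] with h hh hz
    exact absurd hz (pow_ne_zero _ (ne_of_gt hh))
  have hw : Tendsto (fun h : ℝ => eta β (v * h / D) ω + δ * nu β (v * h / D) ω) (𝓝[>] 0)
      (𝓝 ((1 + δ) * nu β 0 ω)) := by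
    have h := ((contDiff_eta D v β ω).add
      (contDiff_const.mul (contDiff_nu D v β ω) : ContDiff ℝ (⊤ : ℕ∞)
        fun h : ℝ => δ * nu β (v * h / D) ω)).continuous.tendsto 0
    simp only [mul_zero, zero_div, eta_zero_eq_nu_zero] at h
    rw [one_add_mul]
    exact h.mono_left nhdsWithin_le_nhds
  have hN := (((contDiff_nu D v β u₀).mul
    (contDiff_prod (t := univ) fun d _ => contDiff_nu D v β (u' d))).continuous.tendsto
      0).mono_left (nhdsWithin_le_nhds (s := Set.Ioi 0))
  have h := (hw.mul hN).mul ((hL 0).add ((hL (1 - ((ω : ℕ) : ℤ))).const_mul ε))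
  have hzero : ∀ N : ℝ, (1 + δ) * nu β 0 ω * N * (L + ε * L) = 0 := fun N => by
    rcases hεδ with h | h <;> rw [h] <;> ring
  rw [hzero] at h
  refine h.congr fun x => ?_
  ring

/-- LOE, Case I with m even and (ε,δ) ≠ (1,1): ⟨A⟩(Δr) = O(Δr^m). -/
theorem LOE_caseI_m_even_other
    (D v β r : ℝ) (k : ℕ) (ρ₀ : ℝ → ℝ) (f : ℝ → ℝ → ℝ)
    (ε δ : ℝ) (m : ℕ) (Chat : ℝ → ℝ)
    (hD : 0 < D) (hβ0 : 0 < β) (hβ1 : β < 1) (hk : 1 ≤ k)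
    (hρ : ContDiff ℝ (⊤ : ℕ∞) ρ₀) (hρpos : ∀ x, 0 < ρ₀ x)
    (hf : ContDiff ℝ (⊤ : ℕ∞) (Function.uncurry f))
    (hε : ε = 1 ∨ ε = -1) (hδ : δ = 1 ∨ δ = -1)
    (hsym : ∀ x y, f y x = (-1 : ℝ) ^ m * f x y)
    (hlow : ∀ Y : ℝ, ∀ j < m, iteratedDeriv j (fun X => ftilde f X Y) 0 = 0)
    (hchar : ∀ Y : ℝ, iteratedDeriv m (fun X => ftilde f X Y) 0 = (m.factorial : ℝ) * Chat Y)
    (hCbdd : ∃ M : ℝ, ∀ y, |Chat y| ≤ M) (hCne : ∀ y, Chat y ≠ 0)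
    (hme : Even m) (hne : ¬(ε = 1 ∧ δ = 1)) :
    ∃ C > 0, ∃ Δ₀ > 0, ∀ Δr : ℝ, 0 < Δr → Δr < Δ₀ →
      |avgA D v β r k ρ₀ f ε δ m Δr| ≤ C * Δr ^ m := by
  have hεδ : ε = -1 ∨ δ = -1 := by
    rcases hε with h1 | h1
    · exact Or.inr (hδ.resolve_left fun h2 => hne ⟨h1, h2⟩)
    · exact Or.inl h1
  have hO := isBigO_pow_add_two_of_even hme
    ((contDiffAt_siteSum D v r hβ0 hβ1 (k - 1) hρ hf ε δ).of_le
      (WithTop.coe_le_coe.2 le_top))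
    (siteSum_neg D v β r (k - 1) ρ₀ f ε δ)
    (siteSum_isLittleO D v r hβ0 hβ1 (k - 1) hρ hf hlow hεδ)
  obtain ⟨c, hc, hbound⟩ := hO.exists_pos
  obtain ⟨Δ₀, hΔ₀, hball⟩ := Metric.eventually_nhds_iff.1 hbound.bound
  refine ⟨c * (2 * D / β), by positivity, Δ₀, hΔ₀, fun h hpos hlt => ?_⟩
  have hb := hball (y := h) (by rwa [Real.dist_eq, sub_zero, abs_of_pos hpos])
  rw [Real.norm_eq_abs, Real.norm_of_nonneg (by positivity)] at hb
  have havg : avgA D v β r k ρ₀ f ε δ m h =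
      siteSum D v β r (k - 1) ρ₀ f ε δ h * (2 * D / (β * h ^ 2)) := by
    have hK : Ksum D v β r k ρ₀ f ε δ m h = h * siteSum D v β r (k - 1) ρ₀ f ε δ h := by
      simp only [Ksum, siteSum, hme.neg_one_pow, mul_one]
    rw [avgA, hK]
    field_simp
  rw [havg, abs_mul, abs_of_pos (show 0 < 2 * D / (β * h ^ 2) by positivity)]
  calc _ ≤ c * h ^ (m + 2) * (2 * D / (β * h ^ 2)) := by gcongr
    _ = c * (2 * D / β) * h ^ m := by
      rw [pow_add]
      field_simp
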